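/- Suppose μ > 0 and λ + μ < 1, and let x = (r,z) ∈ D3. Then the one-step drift of H satisfies the exact identity 𝒟H(x) = E[(λz + r* + N)²] + E[((1−μ)(λ+μ)z + r* + N)²] − (r + λz)² − (r + (λ+μ)z)² with N ~ N(0,σ²), and consequently 𝒟H(x) ≤ 2(r*² + σ² − r²) + 2r*(λ + (λ+μ)(1−μ))z − (λ+μ)²μ(2−μ)z². -/

import Mathlib

open MeasureTheory ProbabilityTheory Filter

noncomputable section

/-- One step of the dynamics, given current state `x = (R, Z)` and noise `n`:
`R' = R − λ·max(−R,0) + λ(λ+μ)Z + max(min(ζ, r* − R), −ξ) + n`,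
`Z' = max(−R,0) + (1−λ−μ)Z`. -/
def step (lam mu zeta xi rstar : ℝ) (x : ℝ × ℝ) (n : ℝ) : ℝ × ℝ :=
  (x.1 - lam * max (-x.1) 0 + lam * (lam + mu) * x.2
      + max (min zeta (rstar - x.1)) (-xi) + n,
   max (-x.1) 0 + (1 - lam - mu) * x.2)

/-- The Gaussian noise distribution `N(0, σ²)`. -/
def noise (sigma : ℝ) : Measure ℝ := gaussianReal 0 (sigma ^ 2).toNNReal

/-- The one-step transition kernel `P(x, ·)`: the law of `step x N` with `N ~ N(0, σ²)`. -/
def kerP (lam mu zeta xi rstar sigma : ℝ) (x : ℝ × ℝ) : Measure (ℝ × ℝ) :=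
  (noise sigma).map (step lam mu zeta xi rstar x)

/-- The `n`-step transition kernel `Pⁿ(x, ·)`. -/
def kerPn (lam mu zeta xi rstar sigma : ℝ) : ℕ → (ℝ × ℝ) → Measure (ℝ × ℝ)
  | 0, x => Measure.dirac x
  | n + 1, x => (kerP lam mu zeta xi rstar sigma x).bind (kerPn lam mu zeta xi rstar sigma n)

/-- Total variation distance between two measures: sup over Borel sets of the
absolute difference. -/
def tvDist (m1 m2 : Measure (ℝ × ℝ)) : ℝ :=
  ⨆ B : { B : Set (ℝ × ℝ) // MeasurableSet B }, |(m1 B).toReal - (m2 B).toReal|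

end

noncomputable section

/-- The Lyapunov function `H(r,z) = (r + λz)² + (r + (λ+μ)z)²`. -/
def lyapH (lam mu : ℝ) (p : ℝ × ℝ) : ℝ :=
  (p.1 + lam * p.2) ^ 2 + (p.1 + (lam + mu) * p.2) ^ 2

/-- The one-step drift of `H`: `𝒟H(x) = E_x[H(X(1))] − H(x)`. -/
def driftH (lam mu zeta xi rstar sigma : ℝ) (x : ℝ × ℝ) : ℝ :=
  (∫ n, lyapH lam mu (step lam mu zeta xi rstar x n) ∂(noise sigma)) - lyapH lam mu x

end

instance isProbabilityMeasure_noise (sigma : ℝ) : IsProbabilityMeasure (noise sigma) := by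
  unfold noise
  infer_instance

lemma integrable_const_add_sq_noise (sigma a : ℝ) :
    Integrable (fun n => (a + n) ^ 2) (noise sigma) :=
  ((memLp_const a).add (memLp_id_gaussianReal 2)).integrable_sq

lemma integral_sq_noise (sigma : ℝ) : ∫ n, n ^ 2 ∂(noise sigma) = sigma ^ 2 := by
  have h := variance_fun_id_gaussianReal (μ := 0) (v := (sigma ^ 2).toNNReal)
  rw [variance_of_integral_eq_zero aemeasurable_id' integral_id_gaussianReal,
    Real.coe_toNNReal _ (sq_nonneg sigma)] at h
  exact h

lemma integral_const_add_sq_noise (sigma a : ℝ) :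
    ∫ n, (a + n) ^ 2 ∂(noise sigma) = a ^ 2 + sigma ^ 2 := by
  have h1 : Integrable (fun n : ℝ => n) (noise sigma) :=
    (memLp_id_gaussianReal 1).integrable (by simp)
  have h2 : Integrable (fun n : ℝ => n ^ 2) (noise sigma) := by
    simpa using integrable_const_add_sq_noise sigma 0
  have h3 : Integrable (fun n : ℝ => a ^ 2 + 2 * a * n) (noise sigma) :=
    (integrable_const _).add (h1.const_mul _)
  have h0 : ∫ n, n ∂(noise sigma) = 0 := integral_id_gaussianReal
  have hexp : ∀ n : ℝ, (a + n) ^ 2 = (a ^ 2 + 2 * a * n) + n ^ 2 := fun n => by ring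
  simp_rw [hexp]
  rw [integral_add h3 h2,
    integral_add (integrable_const _) (h1.const_mul _), integral_const_mul, h0,
    integral_sq_noise]
  simp

lemma step_of_mem_Icc {lam mu zeta xi rstar r z : ℝ} (hr : 0 ≤ r)
    (hr0 : rstar - zeta ≤ r) (hr1 : r ≤ rstar + xi) (n : ℝ) :
    step lam mu zeta xi rstar (r, z) n
      = (lam * (lam + mu) * z + rstar + n, (1 - lam - mu) * z) := by
  have h1 : max (-r) 0 = 0 := max_eq_right (by linarith)
  have h2 : min zeta (rstar - r) = rstar - r := min_eq_right (by linarith)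
  have h3 : max (rstar - r) (-xi) = rstar - r := max_eq_left (by linarith)
  simp only [step, h1, h2, h3, Prod.mk.injEq]
  constructor <;> ring

/-- In domain `D3` (`r* − ζ ≤ r < r* + ξ`), the drift of `H` satisfies the
exact identity
`𝒟H(x) = E[(λz + r* + N)²] + E[((1−μ)(λ+μ)z + r* + N)²] − (r+λz)² − (r+(λ+μ)z)²`
and consequently
`𝒟H(x) ≤ 2(r*² + σ² − r²) + 2r*(λ + (λ+μ)(1−μ))z − (λ+μ)²μ(2−μ)z²`. -/
theorem drift_D3
    (lam mu zeta xi rstar sigma : ℝ)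
    (hlam : 0 < lam) (hzeta : 0 < zeta) (hxi : 0 < xi) (hrstar : zeta < rstar)
    (hsigma : 0 < sigma) (hmu : 0 < mu) (hlm : lam + mu < 1)
    (r z : ℝ) (hr0 : rstar - zeta ≤ r) (hr1 : r < rstar + xi) (hz : 0 ≤ z) :
    driftH lam mu zeta xi rstar sigma (r, z)
      = (∫ n, (lam * z + rstar + n) ^ 2 ∂(noise sigma))
        + (∫ n, ((1 - mu) * (lam + mu) * z + rstar + n) ^ 2 ∂(noise sigma))
        - (r + lam * z) ^ 2 - (r + (lam + mu) * z) ^ 2 ∧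
    driftH lam mu zeta xi rstar sigma (r, z)
      ≤ 2 * (rstar ^ 2 + sigma ^ 2 - r ^ 2)
        + 2 * rstar * (lam + (lam + mu) * (1 - mu)) * z
        - (lam + mu) ^ 2 * mu * (2 - mu) * z ^ 2 := by
  have hr : 0 < r := by linarith
  have hH : ∀ n, lyapH lam mu (step lam mu zeta xi rstar (r, z) n)
      = (lam * z + rstar + n) ^ 2 + ((1 - mu) * (lam + mu) * z + rstar + n) ^ 2 := by
    intro n
    rw [step_of_mem_Icc hr.le hr0 hr1.le]
    simp only [lyapH]
    ring
  have hdrift : driftH lam mu zeta xi rstar sigma (r, z)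
      = (∫ n, (lam * z + rstar + n) ^ 2 ∂(noise sigma))
        + (∫ n, ((1 - mu) * (lam + mu) * z + rstar + n) ^ 2 ∂(noise sigma))
        - (r + lam * z) ^ 2 - (r + (lam + mu) * z) ^ 2 := by
    simp only [driftH, hH]
    rw [integral_add (integrable_const_add_sq_noise _ _) (integrable_const_add_sq_noise _ _)]
    simp only [lyapH]
    ring
  refine ⟨hdrift, ?_⟩
  rw [hdrift, integral_const_add_sq_noise, integral_const_add_sq_noise]
  have hcross : 0 ≤ r * z * (2 * lam + mu) := by positivity
  linarith
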